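/- Let m₂ < m₁ be nonnegative integers with m₁ - m₂ odd, n = m₁+m₂+1, and let 0 < a < b. Suppose f ∈ C^{n+2} on an open interval containing [a,b] with f^{(n+1)}(x) ≠ 0 for all x ∈ (a,b). Let P, Q ∈ π_n be the Hermite interpolants satisfying P^{(j)}(a) = f^{(j)}(a) for j ≤ m₁, P^{(j)}(b) = f^{(j)}(b) for j ≤ m₂, Q^{(j)}(a) = f^{(j)}(a) for j ≤ m₂, Q^{(j)}(b) = f^{(j)}(b) for j ≤ m₁. Then there exists a unique x₀ with a < x₀ < b such that f(x₀) = (P(x₀) + Q(x₀))/2. -/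

import Mathlib

theorem Polynomial.contDiff_eval (p : Polynomial ℝ) {n : WithTop ℕ∞} :
    ContDiff ℝ n (fun t => p.eval t) := by
  simpa using p.contDiff_aeval (𝕜 := ℝ) n

open Polynomial in
theorem Polynomial.iteratedDeriv_eval (p : ℝ[X]) (j : ℕ) :
    iteratedDeriv j (fun t => p.eval t) = fun t => (derivative^[j] p).eval t := by
  induction j with
  | zero => simp
  | succ j ih =>
    rw [iteratedDeriv_succ, ih, Function.iterate_succ_apply']
    funext t
    exact Polynomial.deriv _

open Polynomial in
theorem Polynomial.iterate_derivative_of_natDegree_le {p : ℝ[X]} {N : ℕ} (hp : p.natDegree ≤ N) :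
    derivative^[N] p = C (N.factorial * p.coeff N) := by
  ext i
  rw [coeff_iterate_derivative, coeff_C]
  split_ifs with hi
  · simp [hi, Nat.descFactorial_self]
  · rw [coeff_eq_zero_of_natDegree_lt (by omega), smul_zero]

open Polynomial in
theorem Polynomial.eval_iterate_derivative_of_pow_dvd {p : ℝ[X]} {a : ℝ} {r j : ℕ}
    (hp : (X - C a) ^ r ∣ p) (hj : j < r) : (derivative^[j] p).eval a = 0 := by
  have h := pow_sub_dvd_iterate_derivative_of_pow_dvd j hp
  exact dvd_iff_isRoot.1 ((dvd_pow_self _ (by omega)).trans h)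

/-- Rolle's theorem with multiplicities: the zeros `x 0 ≤ ⋯ ≤ x N` are repeated according to
their multiplicity. -/
theorem exists_iteratedDeriv_eq_zero_of_monotone {N : ℕ} {φ : ℝ → ℝ} (hφ : ContDiff ℝ N φ)
    {x : ℕ → ℝ} (hx : ∀ i < N, x i ≤ x (i + 1)) (hlt : x 0 < x N)
    (hzero : ∀ i j, i ≤ j → j ≤ N → x i = x j → iteratedDeriv (j - i) φ (x i) = 0) :
    ∃ ξ ∈ Set.Ioo (x 0) (x N), iteratedDeriv N φ ξ = 0 := by
  induction N generalizing φ x with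
  | zero => exact absurd hlt (lt_irrefl _)
  | succ N ih =>
    have mono : ∀ i j, i ≤ j → j ≤ N + 1 → x i ≤ x j := by
      intro i j hij
      induction j, hij using Nat.le_induction with
      | base => intro _; exact le_rfl
      | succ j _ ihj => intro hj; exact (ihj (by omega)).trans (hx j (by omega))
    have hval : ∀ i ≤ N + 1, φ (x i) = 0 := fun i hi => by
      simpa using hzero i i le_rfl hi rfl
    have key : ∀ i, ∃ y, i ≤ N → x i ≤ y ∧ y ≤ x (i + 1) ∧ deriv φ y = 0 ∧
        (x i < x (i + 1) → x i < y ∧ y < x (i + 1)) := by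
      intro i
      by_cases hi : i ≤ N
      · rcases (hx i (by omega)).lt_or_eq with h | h
        · obtain ⟨y, hy, hy'⟩ := exists_deriv_eq_zero h hφ.continuous.continuousOn
            ((hval i (by omega)).trans (hval (i + 1) (by omega)).symm)
          exact ⟨y, fun _ => ⟨hy.1.le, hy.2.le, hy', fun _ => hy⟩⟩
        · refine ⟨x i, fun _ => ⟨le_rfl, h.le, ?_, fun h' => absurd h h'.ne⟩⟩
          simpa using hzero i (i + 1) (by omega) (by omega) h
      · exact ⟨0, fun h => absurd h hi⟩
    choose y hy using key
    have hyy : ∀ i j, i < j → j ≤ N → y i = y j → x i = x (j + 1) ∧ y i = x i := by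
      intro i j hij hj h
      obtain ⟨h1, h2, -, h3⟩ := hy i (by omega)
      obtain ⟨h4, h5, -, h6⟩ := hy j hj
      have h7 := mono (i + 1) j (by omega) (by omega)
      have h8 : x i = x (i + 1) := by
        by_contra hne
        have := h3 (lt_of_le_of_ne (h1.trans h2) hne)
        linarith
      have h9 : x j = x (j + 1) := by
        by_contra hne
        have := h6 (lt_of_le_of_ne (h4.trans h5) hne)
        linarith
      constructor <;> linarith
    rcases Nat.eq_zero_or_pos N with rfl | hN
    · obtain ⟨-, -, h, h'⟩ := hy 0 le_rfl
      exact ⟨y 0, h' hlt, by simpa using h⟩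
    · have hmono : ∀ i < N, y i ≤ y (i + 1) := fun i hi =>
        (hy i (by omega)).2.1.trans (hy (i + 1) (by omega)).1
      have hle : y 0 ≤ y N := by
        have h1 := (hy 0 (by omega)).2.1
        have h2 := (hy N le_rfl).1
        have h3 := mono (0 + 1) N (by omega) (by omega)
        linarith
      obtain ⟨ξ, hξ, hξ'⟩ := ih (φ := deriv φ) (x := y)
        (by
          have : ContDiff ℝ ((N : WithTop ℕ∞) + 1) φ := by exact_mod_cast hφ
          exact (contDiff_succ_iff_deriv.1 this).2.2)
        hmono
        (lt_of_le_of_ne hle fun h => hlt.ne (hyy 0 N hN le_rfl h).1)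
        (by
          intro i j hij hj h
          rcases hij.eq_or_lt with rfl | hij
          · simpa using (hy i hj).2.2.1
          · obtain ⟨h1, h2⟩ := hyy i j hij hj h
            have := hzero i (j + 1) (by omega) (by omega) h1
            rwa [show j + 1 - i = (j - i) + 1 by omega, iteratedDeriv_succ', ← h2] at this)
      refine ⟨ξ, ⟨(hy 0 (by omega)).1.trans_lt hξ.1, hξ.2.trans_le (hy N le_rfl).2.1⟩, ?_⟩
      rw [iteratedDeriv_succ', hξ']

open Polynomial in
/-- Mean value form of the leading coefficient of a polynomial `R` interpolating `φ` at `a`, `y`,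
`z`, `b` with multiplicities `r`, `s`, `t`, `q`. -/
theorem exists_iteratedDeriv_eq_factorial_mul_coeff {N r s t q : ℕ} (hN : r + s + t + q = N + 1)
    (hr : 0 < r) (hq : 0 < q) {a y z b : ℝ} (hay : a < y) (hyz : y < z) (hzb : z < b)
    {φ : ℝ → ℝ} (hφ : ContDiff ℝ N φ) {R : ℝ[X]} (hR : R.natDegree ≤ N)
    (hRa : ∀ j < r, iteratedDeriv j φ a = (derivative^[j] R).eval a)
    (hRy : ∀ j < s, iteratedDeriv j φ y = (derivative^[j] R).eval y)
    (hRz : ∀ j < t, iteratedDeriv j φ z = (derivative^[j] R).eval z)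
    (hRb : ∀ j < q, iteratedDeriv j φ b = (derivative^[j] R).eval b) :
    ∃ ξ ∈ Set.Ioo a b, iteratedDeriv N φ ξ = N.factorial * R.coeff N := by
  have hsub : ∀ j ≤ N, ∀ u, iteratedDeriv j (fun v => φ v - R.eval v) u =
      iteratedDeriv j φ u - (derivative^[j] R).eval u := by
    intro j hj u
    rw [iteratedDeriv_fun_sub (hφ.contDiffAt.of_le (by exact_mod_cast hj))
      R.contDiff_eval.contDiffAt, iteratedDeriv_eval]
  let x : ℕ → ℝ := fun i =>
    if i < r then a else if i < r + s then y else if i < r + s + t then z else b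
  have hx0 : x 0 = a := by simp [x, hr]
  have hxN : x N = b := by
    simp only [x]
    rw [if_neg (by omega), if_neg (by omega), if_neg (by omega)]
  obtain ⟨ξ, hξ, h⟩ := exists_iteratedDeriv_eq_zero_of_monotone (N := N)
    (φ := fun v => φ v - R.eval v) (x := x) (hφ.sub R.contDiff_eval)
    (by
      intro i _
      simp only [x]
      split_ifs <;> first | omega | linarith)
    (by rw [hx0, hxN]; linarith)
    (by
      intro i j hij hj h
      rw [hsub _ (by omega), sub_eq_zero]
      simp only [x] at h ⊢
      split_ifs at h ⊢ <;>
        first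
        | omega
        | (exfalso; linarith)
        | exact hRa _ (by omega)
        | exact hRy _ (by omega)
        | exact hRz _ (by omega)
        | exact hRb _ (by omega))
  rw [hx0, hxN] at hξ
  refine ⟨ξ, hξ, ?_⟩
  rw [hsub _ le_rfl, iterate_derivative_of_natDegree_le hR, eval_C] at h
  linarith

open Polynomial in
theorem Polynomial.natDegree_le_and_coeff_pow_mul_pow_mul_linear (a b u v : ℝ) (r q : ℕ) :
    ((X - C a) ^ r * (X - C b) ^ q * (C v * X + C u)).natDegree ≤ r + 1 + q ∧
      ((X - C a) ^ r * (X - C b) ^ q * (C v * X + C u)).coeff (r + 1 + q) = v := by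
  have hW : ((X - C a) ^ r * (X - C b) ^ q).Monic :=
    ((monic_X_sub_C a).pow r).mul ((monic_X_sub_C b).pow q)
  have hd : ((X - C a) ^ r * (X - C b) ^ q).natDegree = r + q := by
    rw [((monic_X_sub_C a).pow r).natDegree_mul ((monic_X_sub_C b).pow q)]
    simp
  have hL : (C v * X + C u).natDegree ≤ 1 := natDegree_linear_le
  refine ⟨natDegree_mul_le.trans (by omega), ?_⟩
  rw [show r + 1 + q = (r + q) + 1 by omega, coeff_mul_add_eq_of_natDegree_le hd.le hL]
  have : ((X - C a) ^ r * (X - C b) ^ q).coeff (r + q) = 1 := hd ▸ hW.coeff_natDegree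
  simp [this]

open Polynomial in
/-- The remainder of two-point Hermite interpolation. -/
theorem exists_eq_pow_mul_pow_mul_iteratedDeriv {r q : ℕ} (hq : 0 < q) {a b : ℝ} {φ : ℝ → ℝ}
    (hφ : ContDiff ℝ (r + 1 + q : ℕ) φ) (hφa : ∀ j ≤ r, iteratedDeriv j φ a = 0)
    (hφb : ∀ j < q, iteratedDeriv j φ b = 0) {y : ℝ} (hy : y ∈ Set.Ioo a b) :
    ∃ ξ ∈ Set.Ioo a b, φ y =
      (y - a) ^ (r + 1) * (y - b) ^ q * (iteratedDeriv (r + 1 + q) φ ξ / (r + 1 + q).factorial) := by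
  have hya : y - a ≠ 0 := sub_ne_zero.2 hy.1.ne'
  have hyb : y - b ≠ 0 := sub_ne_zero.2 hy.2.ne
  set β := φ y / ((y - a) ^ (r + 1) * (y - b) ^ q) with hβ
  obtain ⟨hdeg, hcoeff⟩ := Polynomial.natDegree_le_and_coeff_pow_mul_pow_mul_linear a b (-(β * a)) β r q
  set R : ℝ[X] := (X - C a) ^ r * (X - C b) ^ q * (C β * X + C (-(β * a))) with hR
  have hRa : (X - C a) ^ (r + 1) ∣ R := ⟨(X - C b) ^ q * C β, by
    rw [hR]; simp only [C_neg, C_mul]; ring⟩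
  have hRb : (X - C b) ^ q ∣ R := (dvd_mul_left _ _).mul_right _
  obtain ⟨z, hyz, hzb⟩ := exists_between hy.2
  obtain ⟨ξ, hξ, h⟩ := exists_iteratedDeriv_eq_factorial_mul_coeff (r := r + 1) (s := 1) (t := 0)
    (q := q) (N := r + 1 + q) (by omega) (by omega) hq hy.1 hyz hzb hφ hdeg
    (fun j hj => by
      rw [hφa j (by omega), eval_iterate_derivative_of_pow_dvd hRa hj])
    (fun j hj => by
      obtain rfl : j = 0 := by omega
      simp only [iteratedDeriv_zero, Function.iterate_zero, id_eq, hR, eval_mul, eval_pow,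
        eval_sub, eval_add, eval_X, eval_C, hβ]
      field_simp
      ring)
    (fun j hj => absurd hj (by omega))
    (fun j hj => by rw [hφb j hj, eval_iterate_derivative_of_pow_dvd hRb hj])
  refine ⟨ξ, hξ, ?_⟩
  have hN : ((r + 1 + q).factorial : ℝ) ≠ 0 := by positivity
  rw [h, hcoeff, hβ]
  field_simp

open Polynomial in
theorem strictMonoOn_div_pow_mul_pow {r q : ℕ} (hr : 0 < r) (hq : 0 < q) {a b : ℝ}
    {φ : ℝ → ℝ} (hφ : ContDiff ℝ (r + 1 + q : ℕ) φ) (hφa : ∀ j < r, iteratedDeriv j φ a = 0)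
    (hφb : ∀ j < q, iteratedDeriv j φ b = 0)
    (hpos : ∀ x ∈ Set.Ioo a b, 0 < iteratedDeriv (r + 1 + q) φ x) :
    StrictMonoOn (fun x => φ x / ((x - a) ^ r * (x - b) ^ q)) (Set.Ioo a b) := by
  intro y hy z hz hyz
  have hya : y - a ≠ 0 := sub_ne_zero.2 hy.1.ne'
  have hyb : y - b ≠ 0 := sub_ne_zero.2 hy.2.ne
  have hza : z - a ≠ 0 := sub_ne_zero.2 hz.1.ne'
  have hzb : z - b ≠ 0 := sub_ne_zero.2 hz.2.ne
  have hzy : 0 < z - y := sub_pos.2 hyz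
  set U : ℝ → ℝ := fun x => φ x / ((x - a) ^ r * (x - b) ^ q) with hU
  have hUy : (y - a) ^ r * (y - b) ^ q * U y = φ y := by simp only [hU]; field_simp
  have hUz : (z - a) ^ r * (z - b) ^ q * U z = φ z := by simp only [hU]; field_simp
  set β := (U z - U y) / (z - y) with hβ
  have hβz : β * (z - y) = U z - U y := by rw [hβ]; field_simp
  obtain ⟨hdeg, hcoeff⟩ := Polynomial.natDegree_le_and_coeff_pow_mul_pow_mul_linear a b (U y - β * y) β r q
  set R : ℝ[X] := (X - C a) ^ r * (X - C b) ^ q * (C β * X + C (U y - β * y)) with hR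
  have hRa : (X - C a) ^ r ∣ R := (dvd_mul_right _ _).mul_right _
  have hRb : (X - C b) ^ q ∣ R := (dvd_mul_left _ _).mul_right _
  have hRe : ∀ x, R.eval x = (x - a) ^ r * (x - b) ^ q * (β * x + (U y - β * y)) := by
    intro x; simp [hR]
  obtain ⟨ξ, hξ, h⟩ := exists_iteratedDeriv_eq_factorial_mul_coeff (r := r) (s := 1) (t := 1)
    (q := q) (N := r + 1 + q) (by omega) hr hq hy.1 hyz hz.2 hφ hdeg
    (fun j hj => by rw [hφa j hj, eval_iterate_derivative_of_pow_dvd hRa hj])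
    (fun j hj => by
      obtain rfl : j = 0 := by omega
      rw [iteratedDeriv_zero, Function.iterate_zero, id_eq, hRe, add_sub_cancel, hUy])
    (fun j hj => by
      obtain rfl : j = 0 := by omega
      rw [iteratedDeriv_zero, Function.iterate_zero, id_eq, hRe,
        show β * z + (U y - β * y) = U z by linarith, hUz])
    (fun j hj => by rw [hφb j hj, eval_iterate_derivative_of_pow_dvd hRb hj])
  have hβpos : 0 < β := by
    have := hpos ξ hξ
    rw [h, hcoeff] at this
    exact pos_of_mul_pos_right this (by positivity)
  have := mul_pos hβpos hzy
  linarith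

/-- If `φ` has a zero of order `p` at `a` and of order `q < p` at `b` and its derivative of order
`p + q` is positive, then `φ x / ((x - a) * (x - b)) ^ q` increases from its limit `0` at `a`. -/
theorem strictMonoOn_pos_tendsto_div_mul_pow {p q : ℕ} (hq : 0 < q) (hqp : q < p) {a b : ℝ} {φ : ℝ → ℝ}
    (hφ : ContDiff ℝ (p + q : ℕ) φ) (hφa : ∀ j < p, iteratedDeriv j φ a = 0)
    (hφb : ∀ j < q, iteratedDeriv j φ b = 0)
    (hpos : ∀ x ∈ Set.Ioo a b, 0 < iteratedDeriv (p + q) φ x) :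
    StrictMonoOn (fun x => φ x / ((x - a) * (x - b)) ^ q) (Set.Ioo a b) ∧
      (∀ x ∈ Set.Ioo a b, 0 < φ x / ((x - a) * (x - b)) ^ q) ∧
      Filter.Tendsto (fun x => φ x / ((x - a) * (x - b)) ^ q) (nhdsWithin a (Set.Ioo a b))
        (nhds 0) := by
  obtain ⟨k, rfl⟩ : ∃ k, p = q + k + 1 := ⟨p - q - 1, by omega⟩
  have hN : (0 : ℝ) < (q + k + 1 + q).factorial := by positivity
  have hrem := fun y hy => exists_eq_pow_mul_pow_mul_iteratedDeriv (r := q + k) (y := y) hq hφ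
    (fun j hj => hφa j (by omega)) hφb hy
  have hH : ∀ y ∈ Set.Ioo a b, ∃ ξ ∈ Set.Ioo a b, φ y / ((y - a) * (y - b)) ^ q =
      (y - a) ^ (k + 1) * (iteratedDeriv (q + k + 1 + q) φ ξ / (q + k + 1 + q).factorial) := by
    intro y hy
    have hya : y - a ≠ 0 := sub_ne_zero.2 hy.1.ne'
    have hyb : y - b ≠ 0 := sub_ne_zero.2 hy.2.ne
    obtain ⟨ξ, hξ, h⟩ := hrem y hy
    refine ⟨ξ, hξ, ?_⟩
    rw [h, div_eq_iff (by positivity), mul_pow]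
    ring
  have hHpos : ∀ y ∈ Set.Ioo a b, 0 < φ y / ((y - a) * (y - b)) ^ q := by
    intro y hy
    obtain ⟨ξ, hξ, h⟩ := hH y hy
    rw [h]
    exact mul_pos (pow_pos (sub_pos.2 hy.1) _) (div_pos (hpos ξ hξ) hN)
  have hHU : ∀ y ∈ Set.Ioo a b, φ y / ((y - a) * (y - b)) ^ q =
      (y - a) ^ k * (φ y / ((y - a) ^ (q + k) * (y - b) ^ q)) := by
    intro y hy
    have hya : y - a ≠ 0 := sub_ne_zero.2 hy.1.ne'
    have hyb : y - b ≠ 0 := sub_ne_zero.2 hy.2.ne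
    rw [mul_pow, pow_add]
    field_simp
  refine ⟨?_, hHpos, ?_⟩
  · intro y hy z hz hyz
    have hU := strictMonoOn_div_pow_mul_pow (r := q + k) (by omega) hq hφ
      (fun j hj => hφa j (by omega)) hφb hpos hy hz hyz
    have h1 := hHpos y hy
    simp only [hHU y hy, hHU z hz] at h1 ⊢
    have hya := sub_pos.2 hy.1
    have hza := sub_pos.2 hz.1
    calc _ < (y - a) ^ k * (φ z / ((z - a) ^ (q + k) * (z - b) ^ q)) :=
          mul_lt_mul_of_pos_left hU (by positivity)
      _ ≤ _ := by
          have h2 := pos_of_mul_pos_right h1 (by positivity)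
          exact mul_le_mul_of_nonneg_right (pow_le_pow_left₀ hya.le (by linarith) k)
            (h2.trans hU).le
  · obtain ⟨M, hM⟩ := isCompact_Icc.bddAbove_image
      (f := iteratedDeriv (q + k + 1 + q) φ) (K := Set.Icc a b)
      (hφ.continuous_iteratedDeriv _ le_rfl).continuousOn
    have hlim : Filter.Tendsto (fun x : ℝ => (x - a) ^ (k + 1) * (M / (q + k + 1 + q).factorial))
        (nhdsWithin a (Set.Ioo a b)) (nhds 0) := by
      refine Filter.Tendsto.mono_left ?_ nhdsWithin_le_nhds
      have : Continuous fun x : ℝ => (x - a) ^ (k + 1) * (M / (q + k + 1 + q).factorial) := by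
        fun_prop
      simpa using this.tendsto a
    refine squeeze_zero' ?_ ?_ hlim
    · filter_upwards [self_mem_nhdsWithin] with y hy using (hHpos y hy).le
    · filter_upwards [self_mem_nhdsWithin] with y hy
      obtain ⟨ξ, hξ, h⟩ := hH y hy
      have hya := sub_pos.2 hy.1
      rw [h]
      have : iteratedDeriv (q + k + 1 + q) φ ξ ≤ M :=
        hM ⟨ξ, Set.Ioo_subset_Icc_self hξ, rfl⟩
      gcongr

/-- The reflection of `strictMonoOn_pos_tendsto_div_mul_pow`, for `p + q` odd. -/
theorem strictMonoOn_neg_tendsto_div_mul_pow {p q : ℕ} (hq : 0 < q) (hqp : q < p) (hodd : Odd (p + q))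
    {a b : ℝ} {φ : ℝ → ℝ}
    (hφ : ContDiff ℝ (p + q : ℕ) φ) (hφa : ∀ j < q, iteratedDeriv j φ a = 0)
    (hφb : ∀ j < p, iteratedDeriv j φ b = 0)
    (hpos : ∀ x ∈ Set.Ioo a b, 0 < iteratedDeriv (p + q) φ x) :
    StrictMonoOn (fun x => φ x / ((x - a) * (x - b)) ^ q) (Set.Ioo a b) ∧
      (∀ x ∈ Set.Ioo a b, φ x / ((x - a) * (x - b)) ^ q < 0) ∧
      Filter.Tendsto (fun x => φ x / ((x - a) * (x - b)) ^ q) (nhdsWithin b (Set.Ioo a b))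
        (nhds 0) := by
  have hmem : ∀ x ∈ Set.Ioo a b, a + b - x ∈ Set.Ioo a b := fun x hx =>
    ⟨by linarith [hx.2], by linarith [hx.1]⟩
  have hder : ∀ j x, iteratedDeriv j (fun x => -φ (a + b - x)) x =
      -((-1) ^ j * iteratedDeriv j φ (a + b - x)) := by
    intro j x
    rw [iteratedDeriv_fun_neg, iteratedDeriv_comp_const_sub]
    rfl
  obtain ⟨h1, h2, h3⟩ := strictMonoOn_pos_tendsto_div_mul_pow (φ := fun x => -φ (a + b - x)) (a := a)
    (b := b) hq hqp (hφ.comp (contDiff_const.sub contDiff_id)).neg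
    (fun j hj => by rw [hder, add_sub_cancel_left, hφb j hj]; simp)
    (fun j hj => by rw [hder, add_sub_cancel_right, hφa j hj]; simp)
    (fun x hx => by rw [hder, hodd.neg_one_pow]; linarith [hpos _ (hmem x hx)])
  have heq : ∀ x, -φ (a + b - (a + b - x)) / ((a + b - x - a) * (a + b - x - b)) ^ q =
      -(φ x / ((x - a) * (x - b)) ^ q) := by
    intro x
    rw [sub_sub_cancel, neg_div]
    congr 3
    ring
  refine ⟨fun x hx y hy hxy => ?_, fun x hx => ?_, ?_⟩
  · have := h1 (hmem y hy) (hmem x hx) (by linarith)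
    simp only [heq] at this
    exact neg_lt_neg_iff.1 this
  · have := h2 _ (hmem x hx)
    rw [heq] at this
    linarith
  · have ht : Filter.Tendsto (fun x => a + b - x) (nhdsWithin b (Set.Ioo a b))
        (nhdsWithin a (Set.Ioo a b)) := by
      refine tendsto_nhdsWithin_iff.2 ⟨?_, ?_⟩
      · refine Filter.Tendsto.mono_left ?_ nhdsWithin_le_nhds
        have : Continuous fun x : ℝ => a + b - x := by fun_prop
        simpa using this.tendsto b
      · filter_upwards [self_mem_nhdsWithin] with x hx using hmem x hx
    have := (h3.comp ht).neg
    simpa only [Function.comp_def, heq, neg_neg, neg_zero] using this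

theorem existsUnique_add_eq_zero {p q : ℕ} (hq : 0 < q) (hqp : q < p) (hodd : Odd (p + q))
    {a b : ℝ} (hab : a < b) {φ ψ : ℝ → ℝ}
    (hφ : ContDiff ℝ (p + q : ℕ) φ) (hψ : ContDiff ℝ (p + q : ℕ) ψ)
    (hφa : ∀ j < p, iteratedDeriv j φ a = 0) (hφb : ∀ j < q, iteratedDeriv j φ b = 0)
    (hψa : ∀ j < q, iteratedDeriv j ψ a = 0) (hψb : ∀ j < p, iteratedDeriv j ψ b = 0)
    (hφpos : ∀ x ∈ Set.Ioo a b, 0 < iteratedDeriv (p + q) φ x)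
    (hψpos : ∀ x ∈ Set.Ioo a b, 0 < iteratedDeriv (p + q) ψ x) :
    ∃! x, x ∈ Set.Ioo a b ∧ φ x + ψ x = 0 := by
  obtain ⟨h1, h2, h3⟩ := strictMonoOn_pos_tendsto_div_mul_pow hq hqp hφ hφa hφb hφpos
  obtain ⟨k1, k2, k3⟩ := strictMonoOn_neg_tendsto_div_mul_pow hq hqp hodd hψ hψa hψb hψpos
  have hw : ∀ x ∈ Set.Ioo a b, ((x - a) * (x - b)) ^ q ≠ 0 := fun x hx =>
    pow_ne_zero _ (mul_ne_zero (sub_ne_zero.2 hx.1.ne') (sub_ne_zero.2 hx.2.ne))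
  set S : ℝ → ℝ := fun x => φ x / ((x - a) * (x - b)) ^ q + ψ x / ((x - a) * (x - b)) ^ q with hS
  have hSmono : StrictMonoOn S (Set.Ioo a b) := h1.add k1
  have hSzero : ∀ x ∈ Set.Ioo a b, (S x = 0 ↔ φ x + ψ x = 0) := by
    intro x hx
    simp only [hS, ← add_div, div_eq_zero_iff, hw x hx, or_false]
  have hScont : ContinuousOn S (Set.Ioo a b) := by
    have hwc : ContinuousOn (fun x : ℝ => ((x - a) * (x - b)) ^ q) (Set.Ioo a b) := by fun_prop
    exact (hφ.continuous.continuousOn.div hwc hw).add (hψ.continuous.continuousOn.div hwc hw)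
  obtain ⟨c, hc⟩ := Set.nonempty_Ioo.2 hab
  have hneBotA : (nhdsWithin a (Set.Ioo a b)).NeBot := left_nhdsWithin_Ioo_neBot hab
  have hneBotB : (nhdsWithin b (Set.Ioo a b)).NeBot := right_nhdsWithin_Ioo_neBot hab
  obtain ⟨y, hy, hSy⟩ : ∃ y ∈ Set.Ioo a b, S y ≤ 0 := by
    obtain ⟨y, ⟨hy1, hy⟩, hyc⟩ := (((h3.eventually_lt_const (neg_pos.2 (k2 c hc))).and
      self_mem_nhdsWithin).and (mem_nhdsWithin_of_mem_nhds (Iio_mem_nhds hc.1))).exists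
    refine ⟨y, hy, ?_⟩
    have := k1 hy hc hyc
    simp only [hS] at this ⊢
    linarith
  obtain ⟨z, hz, hSz⟩ : ∃ z ∈ Set.Ioo a b, 0 ≤ S z := by
    obtain ⟨z, ⟨hz1, hz⟩, hzc⟩ := (((k3.eventually_const_lt (neg_neg_of_pos (h2 c hc))).and
      self_mem_nhdsWithin).and (mem_nhdsWithin_of_mem_nhds (Ioi_mem_nhds hc.2))).exists
    refine ⟨z, hz, ?_⟩
    have := h1 hc hz hzc
    simp only [hS] at this ⊢
    linarith
  obtain ⟨x, hx, hSx⟩ := isPreconnected_Ioo.intermediate_value hy hz hScont ⟨hSy, hSz⟩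
  refine ⟨x, ⟨hx, (hSzero x hx).1 hSx⟩, ?_⟩
  rintro x' ⟨hx', h0⟩
  exact hSmono.injOn hx' hx (((hSzero x' hx').2 h0).trans hSx.symm)

/-- A function smooth on a neighbourhood of a compact interval has a globally smooth modification
that agrees with it near the interval. -/
theorem exists_contDiff_eventuallyEq {n : ℕ} {a b c d : ℝ} (hab : a < b) (hca : c < a)
    (hbd : b < d) {f : ℝ → ℝ} (hf : ContDiffOn ℝ n f (Set.Ioo c d)) :
    ∃ g : ℝ → ℝ, ContDiff ℝ n g ∧ ∀ x ∈ Set.Icc a b, g =ᶠ[nhds x] f := by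
  obtain ⟨ε, hε, hεm⟩ := exists_between (lt_min (sub_pos.2 hca) (sub_pos.2 hbd))
  obtain ⟨hε1, hε2⟩ := lt_min_iff.1 hεm
  let χ : ContDiffBump ((a + b) / 2) :=
    ⟨(b - a) / 2 + ε / 2, (b - a) / 2 + ε, by linarith, by linarith⟩
  refine ⟨fun x => χ x * f x, ?_, ?_⟩
  · rw [contDiff_iff_contDiffAt]
    intro x
    by_cases hx : x ∈ Set.Ioo c d
    · exact χ.contDiffAt.mul (hf.contDiffAt (isOpen_Ioo.mem_nhds hx))
    · have hx' : x ∉ tsupport χ := by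
        rw [χ.tsupport_eq, Real.closedBall_eq_Icc]
        rintro ⟨h1, h2⟩
        simp only [χ] at h1 h2
        exact hx ⟨by linarith, by linarith⟩
      have h0 : (fun x => χ x * f x) =ᶠ[nhds x] fun _ => 0 := by
        filter_upwards [notMem_tsupport_iff_eventuallyEq.1 hx'] with y hy
        simp [hy]
      exact contDiffAt_const.congr_of_eventuallyEq h0
  · intro x hx
    have hx' : x ∈ Metric.ball ((a + b) / 2) χ.rIn := by
      rw [Real.ball_eq_Ioo]
      simp only [χ]
      exact ⟨by linarith [hx.1], by linarith [hx.2]⟩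
    filter_upwards [χ.eventuallyEq_one_of_mem_ball hx'] with y hy
    simp [hy]

theorem stmt5 (m₁ m₂ : ℕ) (hm : m₂ < m₁) (hodd : Odd (m₁ - m₂))
    (a b c d : ℝ) (ha : 0 < a) (hab : a < b) (hca : c < a) (hbd : b < d)
    (f : ℝ → ℝ) (hf : ContDiffOn ℝ (m₁ + m₂ + 3 : ℕ) f (Set.Ioo c d))
    (hf' : ∀ x ∈ Set.Ioo a b, iteratedDerivWithin (m₁ + m₂ + 2) f (Set.Ioo c d) x ≠ 0)
    (P Q : Polynomial ℝ) (hPdeg : P.natDegree ≤ m₁ + m₂ + 1) (hQdeg : Q.natDegree ≤ m₁ + m₂ + 1)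
    (hPa : ∀ j ≤ m₁, iteratedDeriv j (fun t => P.eval t) a = iteratedDerivWithin j f (Set.Ioo c d) a)
    (hPb : ∀ j ≤ m₂, iteratedDeriv j (fun t => P.eval t) b = iteratedDerivWithin j f (Set.Ioo c d) b)
    (hQa : ∀ j ≤ m₂, iteratedDeriv j (fun t => Q.eval t) a = iteratedDerivWithin j f (Set.Ioo c d) a)
    (hQb : ∀ j ≤ m₁, iteratedDeriv j (fun t => Q.eval t) b = iteratedDerivWithin j f (Set.Ioo c d) b) :
    ∃! x₀, x₀ ∈ Set.Ioo a b ∧ f x₀ = (P.eval x₀ + Q.eval x₀) / 2 := by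
  obtain ⟨g, hg, hgf⟩ := exists_contDiff_eventuallyEq hab hca hbd
    (hf.of_le (m := ((m₁ + 1 + (m₂ + 1) : ℕ) : WithTop ℕ∞)) (by exact_mod_cast by omega))
  have hN : m₁ + m₂ + 2 = m₁ + 1 + (m₂ + 1) := by omega
  have hIcc : Set.Icc a b ⊆ Set.Ioo c d := fun x hx =>
    ⟨hca.trans_le hx.1, hx.2.trans_lt hbd⟩
  have hder : ∀ j, ∀ x ∈ Set.Icc a b,
      iteratedDerivWithin j f (Set.Ioo c d) x = iteratedDeriv j g x := by
    intro j x hx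
    rw [iteratedDerivWithin_of_isOpen isOpen_Ioo (hIcc hx), (hgf x hx).iteratedDeriv_eq]
  have haI : a ∈ Set.Icc a b := Set.left_mem_Icc.2 hab.le
  have hbI : b ∈ Set.Icc a b := Set.right_mem_Icc.2 hab.le
  have hsmooth : ∀ R : Polynomial ℝ, ContDiff ℝ (m₁ + 1 + (m₂ + 1) : ℕ) (fun x => g x - R.eval x) :=
    fun R => hg.sub R.contDiff_eval
  have hsub : ∀ (R : Polynomial ℝ), ∀ j ≤ m₁ + 1 + (m₂ + 1), ∀ x,
      iteratedDeriv j (fun x => g x - R.eval x) x =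
        iteratedDeriv j g x - iteratedDeriv j (fun t => R.eval t) x := fun R j hj x =>
    iteratedDeriv_fun_sub (hg.contDiffAt.of_le (by exact_mod_cast hj)) R.contDiff_eval.contDiffAt
  have hvanish : ∀ (R : Polynomial ℝ) (m : ℕ) (x : ℝ), m ≤ m₁ → x ∈ Set.Icc a b →
      (∀ j ≤ m, iteratedDeriv j (fun t => R.eval t) x =
        iteratedDerivWithin j f (Set.Ioo c d) x) →
      ∀ j < m + 1, iteratedDeriv j (fun x => g x - R.eval x) x = 0 := by
    intro R m x hm' hx h j hj
    rw [hsub R j (by omega), h j (by omega), hder j x hx, sub_self]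
  have htop : ∀ R : Polynomial ℝ, R.natDegree ≤ m₁ + m₂ + 1 → ∀ x,
      iteratedDeriv (m₁ + 1 + (m₂ + 1)) (fun x => g x - R.eval x) x =
        iteratedDeriv (m₁ + 1 + (m₂ + 1)) g x := by
    intro R hR x
    rw [hsub R _ le_rfl, R.iteratedDeriv_eval,
      Polynomial.iterate_derivative_eq_zero (by omega)]
    simp
  have hodd' : Odd (m₁ + 1 + (m₂ + 1)) := by
    obtain ⟨k, hk⟩ := hodd
    exact ⟨k + m₂ + 1, by omega⟩
  have hne : ∀ x ∈ Set.Ioo a b, iteratedDeriv (m₁ + 1 + (m₂ + 1)) g x ≠ 0 := by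
    intro x hx
    rw [← hder _ x (Set.Ioo_subset_Icc_self hx), ← hN]
    exact hf' x hx
  have hiff : ∀ x, (x ∈ Set.Ioo a b ∧ f x = (P.eval x + Q.eval x) / 2) ↔
      (x ∈ Set.Ioo a b ∧ (g x - P.eval x) + (g x - Q.eval x) = 0) := by
    intro x
    refine and_congr_right fun hx => ?_
    rw [← (hgf x (Set.Ioo_subset_Icc_self hx)).eq_of_nhds]
    constructor <;> intro h <;> linarith
  simp only [hiff]
  have hPa' := hvanish P m₁ a le_rfl haI hPa
  have hPb' := hvanish P m₂ b hm.le hbI hPb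
  have hQa' := hvanish Q m₂ a hm.le haI hQa
  have hQb' := hvanish Q m₁ b le_rfl hbI hQb
  have hsign : (∀ x ∈ Set.Ioo a b, 0 < iteratedDeriv (m₁ + 1 + (m₂ + 1)) g x) ∨
      ∀ x ∈ Set.Ioo a b, iteratedDeriv (m₁ + 1 + (m₂ + 1)) g x < 0 := by
    by_contra! h
    obtain ⟨⟨x, hx, hx'⟩, y, hy, hy'⟩ := h
    obtain ⟨z, hz, hz'⟩ := isPreconnected_Ioo.intermediate_value hx hy
      (hg.continuous_iteratedDeriv _ le_rfl).continuousOn ⟨hx', hy'⟩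
    exact hne z hz hz'
  rcases hsign with hs | hs
  · exact existsUnique_add_eq_zero (by omega) (by omega) hodd' hab (hsmooth P) (hsmooth Q)
      hPa' hPb' hQa' hQb' (fun x hx => by rw [htop P hPdeg]; exact hs x hx)
      (fun x hx => by rw [htop Q hQdeg]; exact hs x hx)
  · have := existsUnique_add_eq_zero (by omega) (by omega) hodd' hab (hsmooth P).neg
      (hsmooth Q).neg
      (fun j hj => by rw [iteratedDeriv_fun_neg, hPa' j hj, neg_zero])
      (fun j hj => by rw [iteratedDeriv_fun_neg, hPb' j hj, neg_zero])
      (fun j hj => by rw [iteratedDeriv_fun_neg, hQa' j hj, neg_zero])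
      (fun j hj => by rw [iteratedDeriv_fun_neg, hQb' j hj, neg_zero])
      (fun x hx => by rw [iteratedDeriv_fun_neg, htop P hPdeg]; linarith [hs x hx])
      (fun x hx => by rw [iteratedDeriv_fun_neg, htop Q hQdeg]; linarith [hs x hx])
    simpa only [← neg_add, neg_eq_zero] using this
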